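/- There exist absolute constants c₁, c₂ > 0 such that the following holds. Let G = (V,E) be a graph on n ≥ 2 vertices, let ε ∈ (0,1), let k be an integer with 1 ≤ k ≤ n, and set λ := c₁·ε²/(log n)² and β := c₂·ε^{-6}·(log n)⁷. Let G^(1),…,G^(k) be a random k-partition of G, and for each i ∈ [k] let C^(i) be an EDCS(G^(i), β, (1−λ)·β) chosen by an arbitrary (deterministic) function of the graph G^(i). Then with probability at least 1 − 4/n⁷, the graph C := C^(1) ∪ … ∪ C^(k) satisfies MM(C) ≥ (2/3 − ε)·MM(G); in particular, the EDCS of each part is a (3/2 + O(ε))-approximation randomized composable coreset of size O(n·β) for maximum matching. -/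

import Mathlib

/-- The degree of vertex `v` in the (sub)graph `H`. -/
noncomputable def deg {V : Type*} (H : SimpleGraph V) (v : V) : ℕ :=
  (H.neighborSet v).ncard

/-- `H` is an edge degree constrained subgraph `EDCS(G, β, β⁻)`. -/
def IsEDCS {V : Type*} (G H : SimpleGraph V) (β βm : ℝ) : Prop :=
  H ≤ G ∧
    (∀ u v : V, H.Adj u v → (deg H u : ℝ) + (deg H v : ℝ) ≤ β) ∧
    (∀ u v : V, G.Adj u v → ¬ H.Adj u v → βm ≤ (deg H u : ℝ) + (deg H v : ℝ))

/-- `M` is a matching of the graph `G`: a set of pairwise vertex-disjoint edges of `G`. -/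
def IsMatching {V : Type*} (G : SimpleGraph V) (M : Set (Sym2 V)) : Prop :=
  M ⊆ G.edgeSet ∧ M.Pairwise fun e f => ∀ v : V, v ∈ e → v ∉ f

/-- `MM G` is the maximum cardinality of a matching in `G`. -/
noncomputable def MM {V : Type*} (G : SimpleGraph V) : ℕ :=
  sSup {n : ℕ | ∃ M : Set (Sym2 V), IsMatching G M ∧ n = M.ncard}

/-- The `i`-th part `G^(i)` of the random `k`-partition of `G` determined by the
assignment `ω` of potential edges to parts: it keeps the edges `e` of `G` with `ω e = i`. -/
def part {V : Type*} (G : SimpleGraph V) {k : ℕ} (ω : Sym2 V → Fin k) (i : Fin k) :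
    SimpleGraph V :=
  G ⊓ SimpleGraph.fromEdgeSet {e | ω e = i}

/-- Probability of the event `A` when each potential edge is assigned independently and
uniformly at random to one of the `k` parts. -/
noncomputable def PrU {V : Type*} [Fintype V] [DecidableEq V] {k : ℕ}
    (A : Set (Sym2 V → Fin k)) : ℝ :=
  (A.ncard : ℝ) / (Fintype.card (Sym2 V → Fin k) : ℝ)

lemma deg_eq_card {V : Type*} [Fintype V] (H : SimpleGraph V) [DecidableRel H.Adj] (v : V) :
    deg H v = (Finset.univ.filter fun u => H.Adj v u).card := by
  rw [deg, ← Set.ncard_coe_finset]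
  congr 1
  ext u
  simp

lemma deg_le_of_edge_bound {V : Type*} [Fintype V] {H : SimpleGraph V} {β : ℝ} (hβ : 0 ≤ β)
    (hH : ∀ u v : V, H.Adj u v → (deg H u : ℝ) + (deg H v : ℝ) ≤ β) (v : V) :
    (deg H v : ℝ) ≤ β := by
  classical
  rcases Nat.eq_zero_or_pos (deg H v) with h | h
  · simpa [h] using hβ
  · rw [deg_eq_card, gt_iff_lt, Finset.card_pos] at h
    obtain ⟨u, hu⟩ := h
    have := hH v u (by simpa using hu)
    have : (0 : ℝ) ≤ deg H u := by positivity
    linarith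

/-- Every graph has an edge degree constrained subgraph with parameters `θ + 1` and `θ - 1`:
maximise `∑ v, (θ * deg v - deg v ^ 2)`. -/
lemma exists_isEDCS {V : Type*} [Fintype V] (G : SimpleGraph V) (θ : ℝ) :
    ∃ H : SimpleGraph V, IsEDCS G H (θ + 1) (θ - 1) := by
  classical
  let Φ : SimpleGraph V → ℝ := fun H => ∑ v, (θ * deg H v - (deg H v : ℝ) ^ 2)
  obtain ⟨H, hHG, hmax⟩ := Finset.exists_max_image
    (Finset.univ.filter fun H : SimpleGraph V => H ≤ G) Φ ⟨⊥, by simp⟩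
  simp only [Finset.mem_filter, Finset.mem_univ, true_and] at hHG hmax
  -- The effect of inserting or removing a single edge on the potential.
  have key : ∀ (H₁ H₂ : SimpleGraph V) (u v : V), u ≠ v →
      (∀ w, deg H₂ w = deg H₁ w + if w = u ∨ w = v then 1 else 0) →
      Φ H₂ = Φ H₁ + 2 * (θ - 1 - deg H₁ u - deg H₁ v) := by
    intro H₁ H₂ u v huv h
    have : ∀ w, θ * deg H₂ w - (deg H₂ w : ℝ) ^ 2 = (θ * deg H₁ w - (deg H₁ w : ℝ) ^ 2) +
        ((if w = u then θ - 1 - 2 * deg H₁ u else 0) +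
          (if w = v then θ - 1 - 2 * deg H₁ v else 0)) := by
      intro w
      rw [h w]
      by_cases h1 : w = u
      · subst h1; simp [huv]; ring
      · by_cases h2 : w = v
        · subst h2; simp [h1]; ring
        · simp [h1, h2]
    simp only [Φ]
    rw [Finset.sum_congr rfl fun w _ => this w, Finset.sum_add_distrib, Finset.sum_add_distrib]
    simp
    ring
  have degree_insert : ∀ (H₁ H₂ : SimpleGraph V) (u v : V), u ≠ v → ¬ H₁.Adj u v →
      (∀ x y, H₂.Adj x y ↔ H₁.Adj x y ∨ (x = u ∧ y = v) ∨ (x = v ∧ y = u)) →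
      ∀ w, deg H₂ w = deg H₁ w + if w = u ∨ w = v then 1 else 0 := by
    intro H₁ H₂ u v huv hn h w
    have hn' : ¬ H₁.Adj v u := fun h => hn h.symm
    rw [deg_eq_card, deg_eq_card]
    by_cases h1 : w = u
    · subst h1
      have : (Finset.univ.filter fun x => H₂.Adj w x) =
          insert v (Finset.univ.filter fun x => H₁.Adj w x) := by
        ext x; simp [h, huv]; tauto
      rw [this, Finset.card_insert_of_notMem (by simpa using hn)]
      simp
    · by_cases h2 : w = v
      · subst h2
        have : (Finset.univ.filter fun x => H₂.Adj w x) =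
            insert u (Finset.univ.filter fun x => H₁.Adj w x) := by
          ext x; simp [h, huv.symm]; tauto
        rw [this, Finset.card_insert_of_notMem (by simpa using hn')]
        simp
      · simp [h, h1, h2]
  refine ⟨H, hHG, fun u v huv => ?_, fun u v hG hH => ?_⟩
  · let H₁ := H.deleteEdges {s(u, v)}
    have h1 := degree_insert H₁ H u v huv.ne (by simp [H₁]) (by
      intro x y
      simp only [H₁, SimpleGraph.deleteEdges_adj, Set.mem_singleton_iff, Sym2.eq_iff]
      constructor
      · tauto
      · rintro (h | ⟨rfl, rfl⟩ | ⟨rfl, rfl⟩)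
        exacts [h.1, huv, huv.symm])
    have h2 := key H₁ H u v huv.ne h1
    have h3 := hmax H₁ ((SimpleGraph.deleteEdges_le _).trans hHG)
    have hu := h1 u
    have hv := h1 v
    simp only [true_or, or_true, if_true] at hu hv
    rw [hu, hv]
    push_cast
    linarith
  · let H₂ := H ⊔ SimpleGraph.fromEdgeSet {s(u, v)}
    have h1 := degree_insert H H₂ u v hG.ne hH (by
      intro x y
      simp only [H₂, SimpleGraph.sup_adj, SimpleGraph.fromEdgeSet_adj, Set.mem_singleton_iff,
        Sym2.eq_iff]
      constructor
      · tauto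
      · rintro (h | ⟨rfl, rfl⟩ | ⟨rfl, rfl⟩)
        exacts [Or.inl h, Or.inr ⟨Or.inl ⟨rfl, rfl⟩, hG.ne⟩, Or.inr ⟨Or.inr ⟨rfl, rfl⟩, hG.ne.symm⟩])
    have h2 := key H H₂ u v hG.ne h1
    have h3 := hmax H₂ (sup_le hHG (by
      intro x y hxy
      simp only [SimpleGraph.fromEdgeSet_adj, Set.mem_singleton_iff, Sym2.eq_iff] at hxy
      rcases hxy.1 with ⟨rfl, rfl⟩ | ⟨rfl, rfl⟩
      exacts [hG, hG.symm]))
    linarith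

lemma sum_card_le_of_symm {V : Type*} [Fintype V] (r : V → V → Prop) [DecidableRel r]
    (hr : ∀ u w, r u w → r w u) (S T : Finset V) (h : ∀ u ∈ S, ∀ w, r u w → w ∈ T) :
    ∑ u ∈ S, (Finset.univ.filter fun w => r u w).card ≤
      ∑ w ∈ T, (Finset.univ.filter fun u => r w u).card := by
  calc ∑ u ∈ S, (Finset.univ.filter fun w => r u w).card
      = ∑ u ∈ S, (T.bipartiteAbove r u).card := by
        refine Finset.sum_congr rfl fun u hu => congrArg Finset.card ?_
        ext w
        simp only [Finset.mem_filter, Finset.mem_univ, true_and, Finset.mem_bipartiteAbove]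
        exact ⟨fun hw => ⟨h u hu w hw, hw⟩, fun hw => hw.2⟩
    _ = ∑ w ∈ T, (S.bipartiteBelow r w).card :=
        Finset.sum_card_bipartiteAbove_eq_sum_card_bipartiteBelow r
    _ ≤ _ := by
        refine Finset.sum_le_sum fun w _ => Finset.card_le_card fun u hu => ?_
        simp only [Finset.mem_bipartiteBelow] at hu
        simpa using hr _ _ hu.2

/-- Two edge degree constrained subgraphs of the same graph have nearly the same degrees. -/
lemma deg_sub_deg_lt {V : Type*} [Fintype V] {G A B : SimpleGraph V} {β γ t : ℝ} (hβ : 0 < β)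
    (hγ : 0 ≤ γ) (ht : 0 < t) (hA : IsEDCS G A β (β - γ)) (hB : IsEDCS G B β (β - γ)) (J : ℕ)
    (hJ : 2 * J * γ ≤ t / 2) (hn : (Fintype.card V : ℝ) ^ 2 < (1 + t / (2 * β)) ^ J) (v : V) :
    (deg A v : ℝ) - deg B v < t := by
  classical
  by_contra! hv
  let a : V → ℕ := fun v => (Finset.univ.filter fun u => A.Adj v u ∧ ¬ B.Adj v u).card
  let b : V → ℕ := fun v => (Finset.univ.filter fun u => B.Adj v u ∧ ¬ A.Adj v u).card
  let D : V → ℝ := fun v => (deg A v : ℝ) - deg B v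
  have hD : ∀ w, D w = a w - b w := by
    intro w
    have h1 : deg A w = (Finset.univ.filter fun u => A.Adj w u ∧ B.Adj w u).card + a w := by
      rw [deg_eq_card, ← Finset.card_filter_add_card_filter_not (fun u => B.Adj w u),
        Finset.filter_filter, Finset.filter_filter]
    have h2 : deg B w = (Finset.univ.filter fun u => A.Adj w u ∧ B.Adj w u).card + b w := by
      rw [deg_eq_card, ← Finset.card_filter_add_card_filter_not (fun u => A.Adj w u),
        Finset.filter_filter, Finset.filter_filter]
      simp only [and_comm, b]
    simp only [D, h1, h2]
    push_cast
    ring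
  have hAB : ∀ u w, A.Adj u w ∧ ¬ B.Adj u w → D u + D w ≤ γ := by
    intro u w h
    have h1 := hA.2.1 u w h.1
    have h2 := hB.2.2 u w (hA.1 h.1) h.2
    simp only [D]
    linarith
  have hBA : ∀ u w, B.Adj u w ∧ ¬ A.Adj u w → -γ ≤ D u + D w := by
    intro u w h
    have h1 := hB.2.1 u w h.1
    have h2 := hA.2.2 u w (hB.1 h.1) h.2
    simp only [D]
    linarith
  have haβ : ∀ w, (a w : ℝ) ≤ β := by
    intro w
    refine le_trans ?_ (deg_le_of_edge_bound hβ.le hA.2.1 w)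
    rw [deg_eq_card]
    refine Nat.cast_le.mpr (Finset.card_le_card fun u hu => ?_)
    simp only [Finset.mem_filter, Finset.mem_univ, true_and] at hu ⊢
    exact hu.1
  let P : ℕ → Finset V := fun j => Finset.univ.filter fun w => t - 2 * j * γ ≤ D w
  let N : ℕ → Finset V := fun j => Finset.univ.filter fun w => D w ≤ -(t - (2 * j + 1) * γ)
  let x : ℕ → ℝ := fun j => ∑ w ∈ P j, (a w : ℝ)
  let q : ℝ := t / (2 * β)
  have hq : 0 < q := by positivity
  have hstep : ∀ j, j + 1 ≤ J → (1 + q) * x j ≤ x (j + 1) := by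
    intro j hj
    have hjJ : 2 * ((j : ℝ) + 1) * γ ≤ t / 2 := by
      refine le_trans ?_ hJ
      have : (j : ℝ) + 1 ≤ J := by exact_mod_cast hj
      gcongr
    have e1 : ∑ w ∈ P j, (a w : ℝ) ≤ ∑ w ∈ N j, (a w : ℝ) := by
      have := sum_card_le_of_symm (fun u w => A.Adj u w ∧ ¬ B.Adj u w)
        (fun u w h => ⟨h.1.symm, fun h' => h.2 h'.symm⟩) (P j) (N j) (by
          intro u hu w huw
          have := hAB u w huw
          simp only [P, N, Finset.mem_filter, Finset.mem_univ, true_and] at hu ⊢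
          linarith)
      exact_mod_cast this
    have e2 : ∑ w ∈ N j, (a w : ℝ) ≤ ∑ w ∈ N j, (b w : ℝ) := by
      refine Finset.sum_le_sum fun w hw => ?_
      simp only [N, Finset.mem_filter, Finset.mem_univ, true_and] at hw
      have := hD w
      linarith
    have e3 : ∑ w ∈ N j, (b w : ℝ) ≤ ∑ w ∈ P (j + 1), (b w : ℝ) := by
      have := sum_card_le_of_symm (fun u w => B.Adj u w ∧ ¬ A.Adj u w)
        (fun u w h => ⟨h.1.symm, fun h' => h.2 h'.symm⟩) (N j) (P (j + 1)) (by
          intro u hu w huw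
          have := hBA u w huw
          simp only [P, N, Finset.mem_filter, Finset.mem_univ, true_and] at hu ⊢
          push_cast
          linarith)
      exact_mod_cast this
    have e4 : ∑ w ∈ P (j + 1), (b w : ℝ) ≤ ∑ w ∈ P (j + 1), (1 - q) * (a w : ℝ) := by
      refine Finset.sum_le_sum fun w hw => ?_
      simp only [P, Finset.mem_filter, Finset.mem_univ, true_and] at hw
      push_cast at hw
      have h1 := hD w
      have h2 : q * a w ≤ t / 2 := by
        calc q * a w ≤ q * β := by gcongr; exact haβ w
          _ = t / 2 := by simp only [q]; field_simp
      linarith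
    rw [← Finset.mul_sum] at e4
    have e5 : x j ≤ (1 - q) * x (j + 1) := e1.trans (e2.trans (e3.trans e4))
    have hx : 0 ≤ x (j + 1) := Finset.sum_nonneg fun w _ => by positivity
    nlinarith [mul_le_mul_of_nonneg_left e5 (by positivity : 0 ≤ 1 + q), mul_nonneg (sq_nonneg q) hx]
  have hgrow : ∀ j, j ≤ J → (1 + q) ^ j ≤ x j := by
    intro j
    induction j with
    | zero =>
      intro _
      have hvP : v ∈ P 0 := by simpa [P, D] using hv
      have h1 : (a v : ℝ) ≤ x 0 :=
        Finset.single_le_sum (f := fun w => (a w : ℝ)) (fun w _ => by positivity) hvP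
      have h2 : 0 < a v := by
        have h3 := hD v
        have h4 : t ≤ D v := hv
        have h5 : (0 : ℝ) ≤ b v := by positivity
        have : (0 : ℝ) < a v := by linarith
        exact_mod_cast this
      have h3 : (1 : ℝ) ≤ a v := by exact_mod_cast h2
      simpa using h3.trans h1
    | succ j ih =>
      intro hj
      calc (1 + q) ^ (j + 1) = (1 + q) * (1 + q) ^ j := by ring
        _ ≤ (1 + q) * x j := by gcongr; exact ih (by omega)
        _ ≤ x (j + 1) := hstep j hj
  have hxJ : x J ≤ (Fintype.card V : ℝ) ^ 2 := by
    calc x J ≤ ∑ w ∈ P J, (Fintype.card V : ℝ) :=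
          Finset.sum_le_sum fun w _ => Nat.cast_le.mpr (Finset.card_le_univ _)
      _ = (P J).card * (Fintype.card V : ℝ) := by simp
      _ ≤ Fintype.card V * (Fintype.card V : ℝ) := by
          gcongr
          exact Finset.card_le_univ _
      _ = _ := by ring
  exact absurd (hgrow J le_rfl) (not_le.mpr (hxJ.trans_lt hn))

/-- Exponential Markov inequality for sums of independent uniform choices, in counting form. -/
lemma card_tail_le {ι κ : Type*} [Fintype ι] [DecidableEq ι] [Fintype κ] (g : ι → κ → ℝ)
    (b : ι → ℝ) {s a : ℝ} (hs : 0 ≤ s)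
    (hg : ∀ e, ∑ j, Real.exp (s * g e j) ≤ Fintype.card κ * Real.exp (b e)) :
    (({ω : ι → κ | a ≤ ∑ e, g e (ω e)} : Set (ι → κ)).ncard : ℝ) ≤
      Fintype.card (ι → κ) * Real.exp (∑ e, b e - s * a) := by
  classical
  have h1 : ∑ ω : ι → κ, Real.exp (s * ∑ e, g e (ω e)) ≤
      Fintype.card (ι → κ) * Real.exp (∑ e, b e) := by
    calc ∑ ω : ι → κ, Real.exp (s * ∑ e, g e (ω e))
        = ∑ ω : ι → κ, ∏ e, Real.exp (s * g e (ω e)) := by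
          simp only [Finset.mul_sum, Real.exp_sum]
      _ = ∏ e, ∑ j, Real.exp (s * g e j) := by
          rw [Finset.prod_univ_sum, Fintype.piFinset_univ]
      _ ≤ ∏ e, (Fintype.card κ * Real.exp (b e)) :=
          Finset.prod_le_prod (fun e _ => Finset.sum_nonneg fun j _ => (Real.exp_pos _).le)
            fun e _ => hg e
      _ = _ := by
          rw [Finset.prod_mul_distrib, ← Real.exp_sum]
          simp
  have h2 : (({ω : ι → κ | a ≤ ∑ e, g e (ω e)} : Set (ι → κ)).ncard : ℝ) * Real.exp (s * a) ≤
      ∑ ω : ι → κ, Real.exp (s * ∑ e, g e (ω e)) := by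
    have : ({ω : ι → κ | a ≤ ∑ e, g e (ω e)} : Set (ι → κ)) =
        ((Finset.univ.filter fun ω : ι → κ => a ≤ ∑ e, g e (ω e) : Finset (ι → κ)) :
          Set (ι → κ)) := by ext; simp
    rw [this, Set.ncard_coe_finset, ← nsmul_eq_mul, ← Finset.sum_const]
    refine (Finset.sum_le_sum fun ω hω => ?_).trans
      (Finset.sum_le_sum_of_subset_of_nonneg (Finset.filter_subset _ Finset.univ)
        fun ω _ _ => (Real.exp_pos _).le)
    have := (Finset.mem_filter.mp hω).2
    gcongr
  rw [Real.exp_sub, ← mul_div_assoc, le_div_iff₀ (Real.exp_pos _)]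
  exact h2.trans h1

lemma sum_exp_centered_le {k : ℕ} (hk : 1 ≤ k) (i : Fin k) {s : ℝ} (hs : |s| ≤ 1) :
    ∑ j : Fin k, Real.exp (s * ((if j = i then 1 else 0) - 1 / (k : ℝ))) ≤
      k * Real.exp (s ^ 2 / k) := by
  have hk' : (0 : ℝ) < k := by exact_mod_cast hk
  have h1 : ∀ j : Fin k, Real.exp (s * ((if j = i then 1 else 0) - 1 / (k : ℝ))) =
      Real.exp (-(s / k)) * (1 + if j = i then Real.exp s - 1 else 0) := by
    intro j
    split_ifs
    · rw [add_sub_cancel, ← Real.exp_add]; congr 1; ring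
    · rw [add_zero, mul_one]; congr 1; ring
  rw [Finset.sum_congr rfl fun j _ => h1 j, ← Finset.mul_sum, Finset.sum_add_distrib]
  simp only [Finset.sum_const, Finset.card_univ, Fintype.card_fin, nsmul_eq_mul, mul_one,
    Finset.sum_ite_eq', Finset.mem_univ, if_true]
  have h2 : Real.exp s - 1 ≤ s + s ^ 2 := by
    have := (abs_le.mp (Real.abs_exp_sub_one_sub_id_le hs)).2
    linarith
  have h3 : (k : ℝ) + (Real.exp s - 1) ≤ k * Real.exp ((s + s ^ 2) / k) := by
    have := Real.add_one_le_exp ((s + s ^ 2) / k)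
    have h4 := mul_le_mul_of_nonneg_left this hk'.le
    rw [mul_add, mul_div_cancel₀ _ hk'.ne'] at h4
    linarith
  calc Real.exp (-(s / k)) * ((k : ℝ) + (Real.exp s - 1))
      ≤ Real.exp (-(s / k)) * (k * Real.exp ((s + s ^ 2) / k)) := by gcongr
    _ = k * (Real.exp (-(s / k)) * Real.exp ((s + s ^ 2) / k)) := by ring
    _ = _ := by rw [← Real.exp_add]; congr 2; ring

/-- Chernoff bound for the number of elements of `S` assigned to the part `i`. -/
lemma card_deviation_le {ι : Type*} [Fintype ι] [DecidableEq ι] {k : ℕ} (hk : 1 ≤ k) (i : Fin k)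
    (S : Finset ι) {μ δ : ℝ} (hμ : (S.card : ℝ) ≤ k * μ) (hδ : 0 ≤ δ)
    (hδ' : δ ≤ 1) :
    (({ω : ι → Fin k | 2 * δ * μ ≤ |((S.filter fun e => ω e = i).card : ℝ) - S.card / k|} :
        Set (ι → Fin k)).ncard : ℝ) ≤
      2 * (Fintype.card (ι → Fin k) * Real.exp (-(δ ^ 2 * μ))) := by
  have hk' : (0 : ℝ) < k := by exact_mod_cast hk
  have hμ' : (S.card : ℝ) / k ≤ μ := by rw [div_le_iff₀ hk']; linarith
  have tail : ∀ σ : ℝ, |σ| = 1 →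
      (({ω : ι → Fin k | 2 * δ * μ ≤
        σ * (((S.filter fun e => ω e = i).card : ℝ) - S.card / k)} :
        Set (ι → Fin k)).ncard : ℝ) ≤
      Fintype.card (ι → Fin k) * Real.exp (-(δ ^ 2 * μ)) := by
    intro σ hσ
    have hσ2 : σ ^ 2 = 1 := by rw [← sq_abs, hσ]; norm_num
    have h := card_tail_le
      (fun (e : ι) (j : Fin k) =>
        if e ∈ S then σ * ((if j = i then 1 else 0) - 1 / (k : ℝ)) else 0)
      (fun e => if e ∈ S then δ ^ 2 / k else 0) (s := δ) (a := 2 * δ * μ) hδ (by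
        intro e
        by_cases he : e ∈ S
        · simp only [he, if_true, Fintype.card_fin]
          have := sum_exp_centered_le hk i (s := δ * σ)
            (by rw [abs_mul, hσ, mul_one, abs_of_nonneg hδ]; exact hδ')
          rw [mul_pow, hσ2, mul_one] at this
          simpa only [mul_assoc] using this
        · simp [he])
    have hsum : ∀ ω : ι → Fin k,
        ∑ e, (if e ∈ S then σ * ((if ω e = i then 1 else 0) - 1 / (k : ℝ)) else 0) =
          σ * (((S.filter fun e => ω e = i).card : ℝ) - S.card / k) := by
      intro ω
      rw [Finset.sum_ite_mem, Finset.univ_inter, ← Finset.mul_sum, Finset.sum_sub_distrib,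
        Finset.sum_boole]
      simp [div_eq_mul_inv]
    simp only [hsum] at h
    refine h.trans ?_
    rw [Finset.sum_ite_mem, Finset.univ_inter, Finset.sum_const, nsmul_eq_mul]
    gcongr
    have : (S.card : ℝ) * (δ ^ 2 / k) = δ ^ 2 * (S.card / k) := by ring
    rw [this]
    nlinarith [mul_le_mul_of_nonneg_left hμ' (sq_nonneg δ)]
  have hsub : ({ω : ι → Fin k | 2 * δ * μ ≤
      |((S.filter fun e => ω e = i).card : ℝ) - S.card / k|} : Set (ι → Fin k)) ⊆
      {ω : ι → Fin k | 2 * δ * μ ≤ 1 * (((S.filter fun e => ω e = i).card : ℝ) - S.card / k)} ∪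
      {ω : ι → Fin k | 2 * δ * μ ≤
        (-1) * (((S.filter fun e => ω e = i).card : ℝ) - S.card / k)} := by
    intro ω hω
    rcases le_abs.mp (Set.mem_ofPred.mp hω) with h | h
    · exact Or.inl (by simpa using h)
    · exact Or.inr (by simpa using h)
  have h1 := tail 1 (by simp)
  have h2 := tail (-1) (by simp)
  have h3 : ((_ : ℕ) : ℝ) ≤ _ := Nat.cast_le.mpr
    ((Set.ncard_le_ncard hsub (Set.toFinite _)).trans (Set.ncard_union_le _ _))
  push_cast at h3
  linarith

/-- Hoeffding bound for a signed sum with real weights. -/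
lemma card_sign_deviation_le {ι : Type*} [Fintype ι] [DecidableEq ι] (c : ι → ℝ) {d a : ℝ}
    (hd : 0 < d) (hc : ∑ r, c r ^ 2 ≤ d) (ha : 0 ≤ a) :
    (({ω : ι → Bool | a ≤ |∑ r, c r * (if ω r then 1 else -1)|} : Set (ι → Bool)).ncard : ℝ) ≤
      2 * (Fintype.card (ι → Bool) * Real.exp (-(a ^ 2 / (2 * d)))) := by
  have tail : ∀ σ : ℝ, σ ^ 2 = 1 →
      (({ω : ι → Bool | a ≤ σ * ∑ r, c r * (if ω r then 1 else -1)} :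
        Set (ι → Bool)).ncard : ℝ) ≤
      Fintype.card (ι → Bool) * Real.exp (-(a ^ 2 / (2 * d))) := by
    intro σ hσ
    have h := card_tail_le (fun (r : ι) (j : Bool) => σ * (c r * (if j then 1 else -1)))
      (fun r => (a / d) ^ 2 / 2 * c r ^ 2) (s := a / d) (a := a) (by positivity) (by
        intro r
        have h1 := Real.cosh_le_exp_half_sq (a / d * (σ * c r))
        rw [Real.cosh_eq] at h1
        have h2 : (a / d * (σ * c r)) ^ 2 / 2 = (a / d) ^ 2 / 2 * c r ^ 2 := by
          rw [mul_pow, mul_pow, hσ]; ring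
        rw [h2] at h1
        simp only [Fintype.sum_bool, Fintype.card_bool, if_true, Bool.false_eq_true, if_false,
          mul_one, mul_neg]
        push_cast
        linarith)
    simp only [← Finset.mul_sum] at h
    refine h.trans ?_
    gcongr
    have h3 : (a / d) ^ 2 / 2 * ∑ r, c r ^ 2 ≤ (a / d) ^ 2 / 2 * d := by gcongr
    have h4 : (a / d) ^ 2 / 2 * d - a / d * a = -(a ^ 2 / (2 * d)) := by field_simp; ring
    linarith
  have hsub : ({ω : ι → Bool | a ≤ |∑ r, c r * (if ω r then 1 else -1)|} : Set (ι → Bool)) ⊆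
      {ω : ι → Bool | a ≤ 1 * ∑ r, c r * (if ω r then 1 else -1)} ∪
      {ω : ι → Bool | a ≤ (-1) * ∑ r, c r * (if ω r then 1 else -1)} := by
    intro ω hω
    rcases le_abs.mp (Set.mem_ofPred.mp hω) with h | h
    · exact Or.inl (by simpa using h)
    · exact Or.inr (by simpa using h)
  have h1 := tail 1 (by simp)
  have h2 := tail (-1) (by simp)
  have h3 : ((_ : ℕ) : ℝ) ≤ _ := Nat.cast_le.mpr
    ((Set.ncard_le_ncard hsub (Set.toFinite _)).trans (Set.ncard_union_le _ _))
  push_cast at h3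
  linarith

/-- Union bound for cardinalities. -/
lemma ncard_iUnion_le_mul {Ω ι : Type*} [Finite Ω] [Fintype ι] (A : ι → Set Ω) {b : ℝ}
    (h : ∀ i, ((A i).ncard : ℝ) ≤ b) : ((⋃ i, A i).ncard : ℝ) ≤ Fintype.card ι * b := by
  classical
  have : ∀ s : Finset ι, ((⋃ i ∈ s, A i).ncard : ℝ) ≤ s.card * b := by
    intro s
    induction s using Finset.induction_on with
    | empty => simp
    | insert i s hi ih =>
      rw [Finset.set_biUnion_insert, Finset.card_insert_of_notMem hi]
      have h1 : (((A i ∪ ⋃ j ∈ s, A j).ncard : ℕ) : ℝ) ≤ _ := Nat.cast_le.mpr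
        (Set.ncard_union_le _ _)
      push_cast at h1 ⊢
      have := h i
      linarith
  simpa using this Finset.univ

lemma bddAbove_matching_sizes {V : Type*} [Fintype V] (G : SimpleGraph V) :
    BddAbove {n : ℕ | ∃ M : Set (Sym2 V), IsMatching G M ∧ n = M.ncard} := by
  refine ⟨(Set.univ : Set (Sym2 V)).ncard, ?_⟩
  rintro n ⟨M, -, rfl⟩
  exact Set.ncard_le_ncard (Set.subset_univ M) (Set.toFinite _)

lemma IsMatching.ncard_le_MM {V : Type*} [Fintype V] {G : SimpleGraph V} {M : Set (Sym2 V)}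
    (hM : IsMatching G M) : M.ncard ≤ MM G :=
  le_csSup (bddAbove_matching_sizes G) ⟨M, hM, rfl⟩

lemma exists_isMatching_ncard_eq_MM {V : Type*} [Fintype V] (G : SimpleGraph V) :
    ∃ M : Set (Sym2 V), IsMatching G M ∧ M.ncard = MM G := by
  obtain ⟨M, hM, h⟩ := Nat.sSup_mem (s := {n : ℕ | ∃ M, IsMatching G M ∧ n = M.ncard})
    ⟨0, ∅, ⟨by simp, by simp⟩, by simp⟩ (bddAbove_matching_sizes G)
  exact ⟨M, hM, h.symm⟩

lemma IsMatching.eq_of_mem {V : Type*} {G : SimpleGraph V} {M : Set (Sym2 V)}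
    (hM : IsMatching G M) {e f : Sym2 V} (he : e ∈ M) (hf : f ∈ M) {v : V} (hve : v ∈ e)
    (hvf : v ∈ f) : e = f := by
  by_contra hne
  exact hM.2 he hf hne v hve hvf

/-- Hall's theorem with deficiency. -/
lemma exists_partial_matching {V : Type*} [Fintype V] [DecidableEq V] (r : V → V → Prop)
    [DecidableRel r] :
    ∃ (A M : Finset V) (g : V → V), Set.InjOn g M ∧ (∀ x ∈ M, r x (g x)) ∧
      (Finset.univ \ A).card + (Finset.univ.filter fun y => ∃ x ∈ A, r x y).card ≤ M.card := by
  classical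
  let N : Finset V → Finset V := fun A => Finset.univ.filter fun y => ∃ x ∈ A, r x y
  obtain ⟨A, -, hA⟩ := Finset.exists_max_image (Finset.univ : Finset (Finset V))
    (fun A => (A.card : ℤ) - (N A).card) ⟨∅, by simp⟩
  have h0 := hA ∅ (by simp)
  simp only [Finset.card_empty, N, Finset.notMem_empty, false_and, exists_false,
    Finset.filter_false] at h0
  obtain ⟨d, hd⟩ : ∃ d : ℕ, (d : ℤ) = (A.card : ℤ) - (N A).card :=
    ⟨((A.card : ℤ) - (N A).card).toNat, Int.toNat_of_nonneg (by simpa using h0)⟩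
  let r' : V → V ⊕ Fin d → Prop := fun x y => Sum.elim (r x) (fun _ => True) y
  obtain ⟨f, hf, hfr⟩ := (Fintype.all_card_le_filter_rel_iff_exists_injective r').mp (by
    intro B
    rcases B.eq_empty_or_nonempty with rfl | ⟨b, hb⟩
    · simp
    · have : (Finset.univ.filter fun y => ∃ x ∈ B, r' x y) = (N B).disjSum Finset.univ := by
        ext y
        rcases y with y | y
        · simp [r', N]
        · simp only [r', Finset.mem_filter, Finset.mem_univ, true_and, Sum.elim_inr, and_true,
            Finset.inr_mem_disjSum, iff_true]
          exact ⟨b, hb⟩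
      rw [this, Finset.card_disjSum, Finset.card_univ, Fintype.card_fin]
      have := hA B (by simp)
      omega)
  refine ⟨A, Finset.univ.filter fun x => (f x).isLeft, fun x => Sum.elim id (fun _ => x) (f x),
    ?_, ?_, ?_⟩
  · intro x hx y hy hxy
    simp only [Finset.coe_filter, Finset.mem_univ, true_and, Set.mem_ofPred_eq,
      Sum.isLeft_iff] at hx hy
    obtain ⟨a, ha⟩ := hx
    obtain ⟨b, hb⟩ := hy
    refine hf ?_
    simp only [ha, hb, Sum.elim_inl, id] at hxy ⊢
    rw [hxy]
  · intro x hx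
    simp only [Finset.mem_filter, Finset.mem_univ, true_and, Sum.isLeft_iff] at hx
    obtain ⟨a, ha⟩ := hx
    have := hfr x
    simpa [ha, r'] using this
  · have h1 := Finset.card_filter_add_card_filter_not (s := (Finset.univ : Finset V))
      (fun x => (f x).isLeft = true)
    have h2 : (Finset.univ.filter fun x => ¬ (f x).isLeft = true).card ≤ d := by
      have : ((Finset.univ.filter fun x => ¬ (f x).isLeft = true).image f).card ≤
          ((Finset.univ : Finset (Fin d)).image (Sum.inr : Fin d → V ⊕ Fin d)).card := by
        refine Finset.card_le_card fun y hy => ?_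
        simp only [Finset.mem_image, Finset.mem_filter, Finset.mem_univ, true_and] at hy ⊢
        obtain ⟨x, hx, rfl⟩ := hy
        rcases h : f x with z | z
        · simp [h] at hx
        · exact ⟨z, rfl⟩
      rw [Finset.card_image_of_injective _ hf] at this
      exact this.trans (Finset.card_image_le.trans (by simp))
    have h3 := Finset.card_sdiff_add_card_eq_card (Finset.subset_univ A)
    have h4 : (N A).card = (Finset.univ.filter fun y => ∃ x ∈ A, r x y).card := rfl
    omega

/-- A weighted bipartite graph in which the endpoints of every edge have degree sum at most `b`
has at most `b` times half the harmonic mean of its side sizes as total weight. -/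
lemma sum_mul_card_add_card_le {α : Type*} (S T : Finset α) (h : α → α → ℝ) {b : ℝ}
    (h0 : ∀ x y, 0 ≤ h x y) (hb : 0 ≤ b)
    (hdeg : ∀ x ∈ S, ∀ y ∈ T,
      h x y * (∑ y' ∈ T, h x y' + ∑ x' ∈ S, h x' y) ≤ h x y * b) :
    (∑ x ∈ S, ∑ y ∈ T, h x y) * (S.card + T.card) ≤ S.card * T.card * b := by
  set E := ∑ x ∈ S, ∑ y ∈ T, h x y with hE
  have hE' : E = ∑ y ∈ T, ∑ x ∈ S, h x y := Finset.sum_comm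
  have hE0 : 0 ≤ E := Finset.sum_nonneg fun x _ => Finset.sum_nonneg fun y _ => h0 x y
  have h1 : ∑ x ∈ S, (∑ y ∈ T, h x y) ^ 2 + ∑ y ∈ T, (∑ x ∈ S, h x y) ^ 2 ≤ b * E := by
    calc ∑ x ∈ S, (∑ y ∈ T, h x y) ^ 2 + ∑ y ∈ T, (∑ x ∈ S, h x y) ^ 2
        = ∑ x ∈ S, ∑ y ∈ T, h x y * (∑ y' ∈ T, h x y') +
          ∑ y ∈ T, ∑ x ∈ S, h x y * (∑ x' ∈ S, h x' y) := by
          simp only [← Finset.sum_mul, sq]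
      _ = ∑ x ∈ S, ∑ y ∈ T, h x y * (∑ y' ∈ T, h x y' + ∑ x' ∈ S, h x' y) := by
          rw [Finset.sum_comm (s := T)]
          simp only [← Finset.sum_add_distrib, ← mul_add]
      _ ≤ ∑ x ∈ S, ∑ y ∈ T, h x y * b :=
          Finset.sum_le_sum fun x hx => Finset.sum_le_sum fun y hy => hdeg x hx y hy
      _ = b * E := by simp only [← Finset.sum_mul]; ring
  have h2 : E ^ 2 ≤ S.card * ∑ x ∈ S, (∑ y ∈ T, h x y) ^ 2 := sq_sum_le_card_mul_sum_sq
  have h3 : E ^ 2 ≤ T.card * ∑ y ∈ T, (∑ x ∈ S, h x y) ^ 2 := hE' ▸ sq_sum_le_card_mul_sum_sq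
  have hS : (0 : ℝ) ≤ S.card := by positivity
  have hT : (0 : ℝ) ≤ T.card := by positivity
  rcases hE0.eq_or_lt with hz | hpos
  · rw [← hz, zero_mul]; positivity
  · have h4 : E * (E * (S.card + T.card)) ≤ E * (S.card * T.card * b) := by
      nlinarith [mul_le_mul_of_nonneg_left h2 hT, mul_le_mul_of_nonneg_left h3 hS,
        mul_le_mul_of_nonneg_left h1 (mul_nonneg hS hT)]
    exact le_of_mul_le_mul_left h4 hpos

lemma mul_le_of_edge_count {m s t c b bm E : ℝ} (hs : 0 ≤ s) (ht : 0 ≤ t) (hbm : 0 < bm)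
    (hb : bm ≤ b) (hm : m ≤ s + t) (htc : t ≤ c) (hE : s * bm ≤ E)
    (h : E * (2 * s + t) ≤ 2 * s * t * b) : m * bm ≤ c * (b + bm / 2) := by
  have hfin : m * bm ≤ t * (b + bm / 2) := by
    have h1 : m * bm ≤ (s + t) * bm := by gcongr
    rcases hs.eq_or_lt with rfl | hpos
    · nlinarith [mul_le_mul_of_nonneg_left hb ht, mul_nonneg ht hbm.le]
    · have h2 : s * (bm * (2 * s + t)) ≤ s * (2 * t * b) := by
        have := mul_le_mul_of_nonneg_right hE (by positivity : 0 ≤ 2 * s + t)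
        linarith
      have h3 := le_of_mul_le_mul_left h2 hpos
      linarith
  have h4 : 0 ≤ b + bm / 2 := by linarith
  exact hfin.trans (mul_le_mul_of_nonneg_right htc h4)

/-- The number of neighbours of `v` in `C` that have a colour different from that of `v`. -/
noncomputable def crossDeg {V : Type*} (C : SimpleGraph V) (χ : V → Bool) (v : V) : ℕ :=
  {u | C.Adj v u ∧ χ u ≠ χ v}.ncard

lemma crossDeg_eq_card {V : Type*} [Fintype V] (C : SimpleGraph V) [DecidableRel C.Adj]
    (χ : V → Bool) (v : V) :
    crossDeg C χ v = (Finset.univ.filter fun u => C.Adj v u ∧ χ u ≠ χ v).card := by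
  rw [crossDeg, ← Set.ncard_coe_finset]
  congr 1
  ext u
  simp

/-- The matching bound for the bipartite subgraph of `C` cut out by a two-colouring. -/
lemma ncard_mul_le_MM_mul {V : Type*} [Fintype V] {G C : SimpleGraph V} {M : Set (Sym2 V)}
    (hM : IsMatching G M) (χ : V → Bool) (hχ : ∀ u v, s(u, v) ∈ M → χ u ≠ χ v) {b bm : ℝ}
    (hbm : 0 < bm) (hb : bm ≤ b)
    (hP1 : ∀ u v, C.Adj u v → χ u ≠ χ v → (crossDeg C χ u : ℝ) + crossDeg C χ v ≤ b)
    (hP2 : ∀ u v, s(u, v) ∈ M → ¬ C.Adj u v → bm ≤ (crossDeg C χ u : ℝ) + crossDeg C χ v) :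
    (M.ncard : ℝ) * bm ≤ MM C * (b + bm / 2) := by
  classical
  obtain ⟨A, K, g, hg, hgr, hK⟩ := exists_partial_matching
    (fun u v => χ u = true ∧ χ v = false ∧ C.Adj u v)
  set B := Finset.univ.filter fun y => ∃ x ∈ A, χ x = true ∧ χ y = false ∧ C.Adj x y with hB
  -- The partial matching is a matching of `C`.
  have hKMM : K.card ≤ MM C := by
    have hinj : Set.InjOn (fun x => s(x, g x)) (K : Set V) := by
      intro x hx y hy hxy
      simp only [Sym2.eq_iff] at hxy
      rcases hxy with h | h
      · exact h.1
      · have h1 := hgr x hx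
        have h2 := hgr y hy
        rw [h.1] at h1
        simp [h1.1] at h2
    have hmat : IsMatching C ((fun x => s(x, g x)) '' (K : Set V)) := by
      refine ⟨?_, ?_⟩
      · rintro _ ⟨x, hx, rfl⟩
        exact (hgr x hx).2.2
      · rintro _ ⟨x, hx, rfl⟩ _ ⟨y, hy, rfl⟩ hne v hv hv'
        have h1 := hgr x hx
        have h2 := hgr y hy
        have hxy : x ≠ y := fun h => hne (by rw [h])
        simp only [Sym2.mem_iff] at hv hv'
        rcases hv with rfl | rfl <;> rcases hv' with h | h
        · exact hxy h
        · rw [← h, h1.1] at h2; simp at h2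
        · rw [h, h2.1] at h1; simp at h1
        · exact hxy (hg hx hy h)
    have := hmat.ncard_le_MM
    rwa [hinj.ncard_image, Set.ncard_coe_finset] at this
  let L := Finset.univ.filter fun u => χ u = true
  let T := (L \ A) ∪ B
  have hLA : (L \ A).card ≤ (Finset.univ \ A).card :=
    Finset.card_le_card (Finset.sdiff_subset_sdiff (Finset.subset_univ _) le_rfl)
  have hT : T.card ≤ MM C :=
    (Finset.card_union_le (L \ A) B).trans ((Nat.add_le_add_right hLA _).trans (hK.trans hKMM))
  let ML := Finset.univ.filter fun u => χ u = true ∧ ∃ v, s(u, v) ∈ M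
  have hp : ∀ u, ∃ v, u ∈ ML → s(u, v) ∈ M := by
    intro u
    by_cases hu : u ∈ ML
    · obtain ⟨v, hv⟩ := (Finset.mem_filter.mp hu).2.2
      exact ⟨v, fun _ => hv⟩
    · exact ⟨u, fun h => absurd h hu⟩
  choose p hp using hp
  have hMLχ : ∀ u ∈ ML, χ u = true := fun u hu => (Finset.mem_filter.mp hu).2.1
  have hpχ : ∀ u ∈ ML, χ (p u) = false := by
    intro u hu
    have := hχ _ _ (hp u hu)
    rw [hMLχ u hu] at this
    simpa using this.symm
  have hpinj : Set.InjOn p (ML : Set V) := by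
    intro x hx y hy hxy
    have h := hM.eq_of_mem (hp x hx) (hp y hy) (v := p x) (by simp) (by simp [hxy])
    rw [hxy] at h
    exact Sym2.congr_left.mp h
  have hMML : M.ncard ≤ ML.card := by
    have hsub : M ⊆ ((ML.image fun u => s(u, p u) : Finset (Sym2 V)) : Set (Sym2 V)) := by
      intro e he
      have : ∃ u ∈ ML, u ∈ e := by
        induction e using Sym2.ind with
        | _ u v =>
          have h1 := hχ u v he
          rcases hu : χ u with _ | _
          · refine ⟨v, ?_, by simp⟩
            have : χ v = true := by
              rw [hu] at h1
              simpa using h1.symm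
            exact Finset.mem_filter.mpr ⟨Finset.mem_univ _, this, u, Sym2.eq_swap ▸ he⟩
          · exact ⟨u, Finset.mem_filter.mpr ⟨Finset.mem_univ _, hu, v, he⟩, by simp⟩
      obtain ⟨u, hu, hue⟩ := this
      simp only [Finset.coe_image, Set.mem_image]
      exact ⟨u, hu, hM.eq_of_mem (hp u hu) he (by simp) hue⟩
    refine (Set.ncard_le_ncard hsub (Set.toFinite _)).trans ?_
    rw [Set.ncard_coe_finset]
    exact Finset.card_image_le
  let M' := ML.filter fun u => u ∈ A ∧ p u ∉ B
  have hM'ML : ∀ u ∈ M', u ∈ ML := fun u hu => (Finset.mem_filter.mp hu).1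
  have hdisj : Disjoint (L \ A) B := by
    rw [Finset.disjoint_left]
    intro u hu hu'
    simp only [L, hB, Finset.mem_sdiff, Finset.mem_filter, Finset.mem_univ, true_and] at hu hu'
    obtain ⟨x, _, _, h, _⟩ := hu'
    rw [hu.1] at h
    simp at h
  have hMLM' : ML.card ≤ M'.card + T.card := by
    have hsub : ML ⊆ M' ∪ ((L \ A) ∪ ML.filter fun u => p u ∈ B) := by
      intro u hu
      have := hMLχ u hu
      simp only [M', L, Finset.mem_union, Finset.mem_filter, Finset.mem_sdiff, Finset.mem_univ,
        true_and]
      tauto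
    have h1 : (ML.filter fun u => p u ∈ B).card ≤ B.card := by
      refine Finset.card_le_card_of_injOn p (fun u hu => ?_) (hpinj.mono ?_)
      · exact (Finset.mem_filter.mp hu).2
      · exact Finset.coe_subset.mpr (Finset.filter_subset _ _)
    have h2 := Finset.card_le_card hsub
    have h3 := Finset.card_union_le M' ((L \ A) ∪ ML.filter fun u => p u ∈ B)
    have h4 := Finset.card_union_le (L \ A) (ML.filter fun u => p u ∈ B)
    have h5 : T.card = (L \ A).card + B.card := Finset.card_union_of_disjoint hdisj
    omega
  let S := M' ∪ M'.image p
  have hSdisj : Disjoint M' (M'.image p) := by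
    rw [Finset.disjoint_left]
    intro u hu hu'
    obtain ⟨w, hw, rfl⟩ := Finset.mem_image.mp hu'
    have h1 := hMLχ _ (hM'ML _ hu)
    rw [hpχ w (hM'ML w hw)] at h1
    simp at h1
  have hpinj' : Set.InjOn p (M' : Set V) := hpinj.mono fun u hu => hM'ML u hu
  have hScard : S.card = 2 * M'.card := by
    rw [Finset.card_union_of_disjoint hSdisj, Finset.card_image_of_injOn hpinj']
    ring
  let h : V → V → ℝ := fun u v => if C.Adj u v ∧ χ v ≠ χ u then 1 else 0
  have hcd : ∀ v, (crossDeg C χ v : ℝ) = ∑ u, h v u := by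
    intro v
    rw [crossDeg_eq_card]
    simp only [h]
    rw [Finset.sum_boole]
  have hsymm : ∀ u v, h u v = h v u := by
    intro u v
    simp only [h, C.adj_comm u v, ne_comm]
  have h0 : ∀ u v, 0 ≤ h u v := by
    intro u v
    simp only [h]
    split_ifs <;> norm_num
  -- All crossing edges leaving `S` end in `T`.
  have hST : ∀ x ∈ S, ∑ y ∈ T, h x y = crossDeg C χ x := by
    intro x hx
    rw [hcd]
    refine Finset.sum_subset (Finset.subset_univ _) fun y _ hy => ?_
    by_contra hne
    have hxy : C.Adj x y ∧ χ y ≠ χ x := by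
      by_contra hn
      exact hne (by simp only [h]; rw [if_neg hn])
    apply hy
    rcases Finset.mem_union.mp hx with hx | hx
    · have hxA := (Finset.mem_filter.mp hx).2.1
      have hxt := hMLχ x (hM'ML x hx)
      have : y ∈ B := by
        simp only [hB, Finset.mem_filter, Finset.mem_univ, true_and]
        exact ⟨x, hxA, hxt, by simpa [hxt] using hxy.2, hxy.1⟩
      exact Finset.mem_union_right _ this
    · obtain ⟨w, hw, rfl⟩ := Finset.mem_image.mp hx
      have hwB := (Finset.mem_filter.mp hw).2.2
      have hpw := hpχ w (hM'ML w hw)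
      have hyt : χ y = true := by simpa [hpw] using hxy.2
      refine Finset.mem_union_left _ (Finset.mem_sdiff.mpr ⟨by simpa [L] using hyt, fun hyA => ?_⟩)
      apply hwB
      simp only [hB, Finset.mem_filter, Finset.mem_univ, true_and]
      exact ⟨y, hyA, hyt, hpw, hxy.1.symm⟩
  have hmain := sum_mul_card_add_card_le S T h (b := b) h0 (hbm.le.trans hb) (by
    intro x hx y _
    by_cases hxy : C.Adj x y ∧ χ y ≠ χ x
    · refine mul_le_mul_of_nonneg_left ?_ (h0 _ _)
      rw [hST x hx]
      have h1 : ∑ x' ∈ S, h x' y ≤ crossDeg C χ y := by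
        rw [hcd]
        simp only [hsymm _ y]
        exact Finset.sum_le_sum_of_subset_of_nonneg (Finset.subset_univ _) fun z _ _ => h0 _ _
      have := hP1 x y hxy.1 hxy.2.symm
      linarith
    · have : h x y = 0 := by simp only [h]; rw [if_neg hxy]
      simp [this])
  have hElow : M'.card * bm ≤ ∑ x ∈ S, ∑ y ∈ T, h x y := by
    rw [Finset.sum_congr rfl hST, Finset.sum_union hSdisj, Finset.sum_image hpinj',
      ← Finset.sum_add_distrib, ← nsmul_eq_mul]
    refine Finset.card_nsmul_le_sum _ _ _ fun u hu => ?_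
    refine hP2 u (p u) (hp u (hM'ML u hu)) fun hadj => ?_
    apply (Finset.mem_filter.mp hu).2.2
    simp only [hB, Finset.mem_filter, Finset.mem_univ, true_and]
    exact ⟨u, (Finset.mem_filter.mp hu).2.1, hMLχ u (hM'ML u hu), hpχ u (hM'ML u hu), hadj⟩
  rw [hScard, Nat.cast_mul, Nat.cast_two] at hmain
  exact mul_le_of_edge_count (by positivity) (by positivity) hbm hb
    (by exact_mod_cast hMML.trans hMLM') (by exact_mod_cast hT) hElow hmain

/-- A two-colouring that separates the endpoints of every edge of a matching and splits all
neighbourhoods almost evenly. -/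
lemma exists_balanced_coloring {V : Type*} [Fintype V] {G C : SimpleGraph V} {M : Set (Sym2 V)}
    (hM : IsMatching G M) {a d : ℝ} (hd : 0 < d) (ha : 0 ≤ a) (hC : ∀ v, (deg C v : ℝ) ≤ d)
    (hn : 2 * (Fintype.card V : ℝ) * Real.exp (-(a ^ 2 / (2 * d))) < 1) :
    ∃ χ : V → Bool, (∀ u v, s(u, v) ∈ M → χ u ≠ χ v) ∧
      ∀ v, |(crossDeg C χ v : ℝ) - deg C v / 2| ≤ a / 2 := by
  classical
  let cls : V → Sym2 V := fun v => if h : ∃ e ∈ M, v ∈ e then h.choose else s(v, v)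
  have hcls : ∀ v, v ∈ cls v := by
    intro v
    by_cases h : ∃ e ∈ M, v ∈ e
    · simp only [cls, dif_pos h]; exact h.choose_spec.2
    · simp only [cls, dif_neg h]; simp
  have hclsM : ∀ e ∈ M, ∀ v ∈ e, cls v = e := by
    intro e he v hv
    have h : ∃ e ∈ M, v ∈ e := ⟨e, he, hv⟩
    simp only [cls, dif_pos h]
    exact hM.eq_of_mem h.choose_spec.1 he h.choose_spec.2 hv
  let sgn : V → ℝ := fun v => if v = (Quot.out (cls v)).1 then 1 else -1
  have hsgn2 : ∀ v, sgn v * sgn v = 1 := by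
    intro v; simp only [sgn]; split_ifs <;> norm_num
  have hopp : ∀ u v, u ≠ v → cls u = cls v → sgn u * sgn v = -1 := by
    intro u v huv h
    have h1 : cls u = s(u, v) := (Sym2.mem_and_mem_iff huv).mp ⟨hcls u, h ▸ hcls v⟩
    have h2 : s((Quot.out (cls u)).1, (Quot.out (cls u)).2) = s(u, v) := by
      rw [← h1]; exact Quot.out_eq (cls u)
    simp only [sgn, ← h]
    rcases Sym2.eq_iff.mp h2 with h3 | h3
    · rw [h3.1]; simp [huv.symm]
    · rw [h3.1]; simp [huv]
  let flip : Bool → ℝ := fun c => if c then 1 else -1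
  have hflip2 : ∀ c, flip c * flip c = 1 := by
    intro c; cases c <;> simp [flip]
  let c : V → Sym2 V → ℝ := fun v r =>
    ∑ u ∈ Finset.univ.filter (fun u => C.Adj v u) with cls u = r, sgn u
  have hc2 : ∀ v, ∑ r, c v r ^ 2 ≤ d := by
    intro v
    refine le_trans ?_ (hC v)
    have h1 : ∀ r, c v r ^ 2 ≤
        (((Finset.univ.filter fun u => C.Adj v u).filter fun u => cls u = r).card : ℝ) := by
      intro r
      simp only [c]
      set X := (Finset.univ.filter fun u => C.Adj v u).filter fun u => cls u = r with hX
      rw [sq, Finset.sum_mul_sum, Finset.card_eq_sum_ones, Nat.cast_sum]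
      refine Finset.sum_le_sum fun u hu => ?_
      calc ∑ w ∈ X, sgn u * sgn w ≤ ∑ w ∈ X, if w = u then (1 : ℝ) else 0 := by
            refine Finset.sum_le_sum fun w hw => ?_
            by_cases hwu : w = u
            · subst hwu; simp [hsgn2]
            · rw [hopp u w (Ne.symm hwu)
                ((Finset.mem_filter.mp hu).2.trans (Finset.mem_filter.mp hw).2.symm)]
              simp [hwu]
        _ ≤ _ := by simp [hu]
    refine (Finset.sum_le_sum fun r _ => h1 r).trans ?_
    rw [deg_eq_card, ← Nat.cast_sum]
    exact (congrArg Nat.cast (Finset.card_eq_sum_card_fiberwise (t := Finset.univ)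
      (f := cls) (by intro x _; simp)).symm).le
  have hbad := ncard_iUnion_le_mul
    (fun v => ({ω : Sym2 V → Bool | a ≤ |∑ r, c v r * (if ω r then 1 else -1)|} :
      Set (Sym2 V → Bool)))
    (fun v => card_sign_deviation_le (c v) hd (hc2 v) ha)
  have hlt : ((⋃ v, ({ω : Sym2 V → Bool | a ≤ |∑ r, c v r * (if ω r then 1 else -1)|} :
      Set (Sym2 V → Bool))).ncard : ℝ) < Fintype.card (Sym2 V → Bool) := by
    refine hbad.trans_lt ?_
    have hpos : (0 : ℝ) < Fintype.card (Sym2 V → Bool) := by exact_mod_cast Fintype.card_pos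
    calc _ = (2 * (Fintype.card V : ℝ) * Real.exp (-(a ^ 2 / (2 * d)))) *
          Fintype.card (Sym2 V → Bool) := by ring
      _ < 1 * Fintype.card (Sym2 V → Bool) := by gcongr
      _ = _ := one_mul _
  obtain ⟨ω, hω⟩ : ∃ ω, ω ∉ ⋃ v, ({ω : Sym2 V → Bool |
      a ≤ |∑ r, c v r * (if ω r then 1 else -1)|} : Set (Sym2 V → Bool)) := by
    by_contra! hall
    rw [Set.eq_univ_of_forall hall, Set.ncard_univ, Nat.card_eq_fintype_card] at hlt
    exact lt_irrefl _ hlt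
  simp only [Set.mem_iUnion, Set.mem_ofPred_eq, not_exists, not_le] at hω
  let spin : V → ℝ := fun v => sgn v * flip (ω (cls v))
  have hspin2 : ∀ v, spin v * spin v = 1 := by
    intro v
    calc spin v * spin v = (sgn v * sgn v) * (flip (ω (cls v)) * flip (ω (cls v))) := by
          simp only [spin]; ring
      _ = 1 := by rw [hsgn2, hflip2, one_mul]
  have hspin : ∀ v, spin v = 1 ∨ spin v = -1 := fun v => mul_self_eq_one_iff.mp (hspin2 v)
  let χ : V → Bool := fun v => decide (spin v = 1)
  have hind : ∀ u v, (if χ u ≠ χ v then (1 : ℝ) else 0) = 1 / 2 - spin v / 2 * spin u := by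
    intro u v
    rcases hspin u with h | h <;> rcases hspin v with h' | h' <;> simp only [χ, h, h'] <;> norm_num
  refine ⟨χ, fun u v huv => ?_, fun v => ?_⟩
  · have hne : u ≠ v := (hM.1 huv : G.Adj u v).ne
    have h1 : cls u = cls v := by
      rw [hclsM _ huv u (by simp), hclsM _ huv v (by simp)]
    have h2 : spin v * spin u = -1 := by
      simp only [spin, h1]
      calc _ = (sgn u * sgn v) * (flip (ω (cls v)) * flip (ω (cls v))) := by ring
        _ = -1 := by rw [hopp u v hne h1, hflip2, mul_one]
    have h3 := hind u v
    by_contra h4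
    rw [if_neg (not_not.mpr h4)] at h3
    linarith
  · have h1 : (crossDeg C χ v : ℝ) =
        ∑ u ∈ Finset.univ.filter (fun u => C.Adj v u), (1 / 2 - spin v / 2 * spin u) := by
      rw [crossDeg_eq_card, ← Finset.filter_filter, ← Finset.sum_boole]
      exact Finset.sum_congr rfl fun u _ => hind u v
    have h2 : ∑ u ∈ Finset.univ.filter (fun u => C.Adj v u), spin u =
        ∑ r, c v r * (if ω r then 1 else -1) := by
      rw [← Finset.sum_fiberwise_of_maps_to (g := cls) (t := Finset.univ) (by simp)]
      refine Finset.sum_congr rfl fun r _ => ?_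
      simp only [c]
      rw [Finset.sum_mul]
      refine Finset.sum_congr rfl fun u hu => ?_
      simp only [spin, flip, (Finset.mem_filter.mp hu).2]
    rw [Finset.sum_sub_distrib, ← Finset.mul_sum, h2, Finset.sum_const, ← deg_eq_card,
      nsmul_eq_mul] at h1
    have h3 := hω v
    have h4 : (crossDeg C χ v : ℝ) - deg C v / 2 =
        -(spin v / 2 * ∑ r, c v r * (if ω r then 1 else -1)) := by
      rw [h1]; ring
    have h5 : |spin v| = 1 := by rcases hspin v with h | h <;> simp [h]
    rw [h4, abs_neg, abs_mul, abs_div, h5, abs_two]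
    linarith

/-- The maximum matching of an edge degree constrained subgraph, with explicit error terms. -/
lemma MM_mul_le_of_isEDCS {V : Type*} [Fintype V] {G C : SimpleGraph V} {b bm a : ℝ}
    (hC : IsEDCS G C b bm) (ha : 0 ≤ a) (hbm : 0 < bm / 2 - a) (hb : bm ≤ b)
    (hn : 2 * (Fintype.card V : ℝ) * Real.exp (-(a ^ 2 / (2 * b))) < 1) :
    (MM G : ℝ) * (bm / 2 - a) ≤ MM C * (b / 2 + a + (bm / 2 - a) / 2) := by
  obtain ⟨M, hM, hMM⟩ := exists_isMatching_ncard_eq_MM G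
  have hb0 : 0 < b := by linarith
  obtain ⟨χ, hχ, hbal⟩ := exists_balanced_coloring hM hb0 ha
    (deg_le_of_edge_bound hb0.le hC.2.1) hn
  rw [← hMM]
  refine ncard_mul_le_MM_mul hM χ hχ hbm (by linarith) (fun u v huv _ => ?_)
    fun u v huv hn => ?_
  · have h1 := (abs_le.mp (hbal u)).2
    have h2 := (abs_le.mp (hbal v)).2
    have h3 := hC.2.1 u v huv
    linarith
  · have h1 := (abs_le.mp (hbal u)).1
    have h2 := (abs_le.mp (hbal v)).1
    have h3 := hC.2.2 u v (hM.1 huv) hn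
    linarith

lemma part_adj {V : Type*} {G : SimpleGraph V} {k : ℕ} {ω : Sym2 V → Fin k} {i : Fin k}
    {u v : V} : (part G ω i).Adj u v ↔ G.Adj u v ∧ ω s(u, v) = i := by
  simp only [part, SimpleGraph.inf_adj, SimpleGraph.fromEdgeSet_adj, Set.mem_ofPred_eq]
  exact ⟨fun h => ⟨h.1, h.2.1⟩, fun h => ⟨h.1, h.2, h.1.ne⟩⟩

lemma deg_iSup_of_le_part {V : Type*} [Fintype V] {G : SimpleGraph V} {k : ℕ}
    {ω : Sym2 V → Fin k} {F : Fin k → SimpleGraph V} (hF : ∀ i, F i ≤ part G ω i) (v : V) :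
    deg (⨆ i, F i) v = ∑ i, deg (F i) v := by
  classical
  rw [deg_eq_card, Finset.card_eq_sum_card_fiberwise (t := Finset.univ)
    (f := fun u => ω s(v, u)) (by intro x _; simp)]
  refine Finset.sum_congr rfl fun i _ => ?_
  rw [deg_eq_card]
  congr 1
  ext u
  simp only [SimpleGraph.iSup_adj, Finset.mem_filter, Finset.mem_univ, true_and]
  constructor
  · rintro ⟨⟨j, hj⟩, h⟩
    rw [(part_adj.mp (hF j hj)).2] at h
    exact h ▸ hj
  · intro h
    exact ⟨⟨i, h⟩, (part_adj.mp (hF i h)).2⟩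

/-- The union of edge degree constrained subgraphs of the parts is one of the whole graph when
all of them have nearly the same degrees. -/
lemma isEDCS_iSup {V : Type*} [Fintype V] {G : SimpleGraph V} {k : ℕ} {ω : Sym2 V → Fin k}
    {F : Fin k → SimpleGraph V} {b bm ρ : ℝ} (x : V → ℝ)
    (hF : ∀ i, IsEDCS (part G ω i) (F i) b bm) (hx : ∀ i v, |(deg (F i) v : ℝ) - x v| ≤ ρ) :
    IsEDCS G (⨆ i, F i) (k * (b + 4 * ρ)) (k * (bm - 4 * ρ)) := by
  have hdeg : ∀ v, |(deg (⨆ i, F i) v : ℝ) - k * x v| ≤ k * ρ := by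
    intro v
    rw [deg_iSup_of_le_part (fun i => (hF i).1) v]
    calc |((∑ i, deg (F i) v : ℕ) : ℝ) - k * x v| = |∑ i : Fin k, ((deg (F i) v : ℝ) - x v)| := by
          simp
      _ ≤ ∑ i : Fin k, |(deg (F i) v : ℝ) - x v| := Finset.abs_sum_le_sum_abs _ _
      _ ≤ ∑ _i : Fin k, ρ := Finset.sum_le_sum fun i _ => hx i v
      _ = k * ρ := by simp
  have hk0 : (0 : ℝ) ≤ k := by positivity
  refine ⟨iSup_le fun i => (hF i).1.trans inf_le_left, fun u v huv => ?_, fun u v hG hn => ?_⟩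
  · obtain ⟨i, hi⟩ := SimpleGraph.iSup_adj.mp huv
    have h1 := (hF i).2.1 u v hi
    have h2 := (abs_le.mp (hx i u)).1
    have h3 := (abs_le.mp (hx i v)).1
    have h4 := (abs_le.mp (hdeg u)).2
    have h5 := (abs_le.mp (hdeg v)).2
    have h6 : x u + x v ≤ b + 2 * ρ := by linarith
    linarith [mul_le_mul_of_nonneg_left h6 hk0]
  · have h1 := (hF (ω s(u, v))).2.2 u v (part_adj.mpr ⟨hG, rfl⟩)
      fun h => hn (SimpleGraph.iSup_adj.mpr ⟨_, h⟩)
    have h2 := (abs_le.mp (hx (ω s(u, v)) u)).2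
    have h3 := (abs_le.mp (hx (ω s(u, v)) v)).2
    have h4 := (abs_le.mp (hdeg u)).1
    have h5 := (abs_le.mp (hdeg v)).1
    have h6 : bm - 2 * ρ ≤ x u + x v := by linarith
    linarith [mul_le_mul_of_nonneg_left h6 hk0]

lemma isEDCS_part {V : Type*} {G H : SimpleGraph V} {k : ℕ} {ω : Sym2 V → Fin k} {i : Fin k}
    {b bm ρ : ℝ} (hk : 1 ≤ k) (hH : IsEDCS G H (k * b) (k * bm))
    (hω : ∀ v, |(deg (part H ω i) v : ℝ) - deg H v / k| ≤ ρ) :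
    IsEDCS (part G ω i) (part H ω i) (b + 2 * ρ) (bm - 2 * ρ) := by
  have hk' : (0 : ℝ) < k := by exact_mod_cast hk
  refine ⟨inf_le_inf_right _ hH.1, fun u v huv => ?_, fun u v hG hn => ?_⟩
  · have h1 := hH.2.1 u v (part_adj.mp huv).1
    have h2 := (abs_le.mp (hω u)).2
    have h3 := (abs_le.mp (hω v)).2
    have h4 : (deg H u : ℝ) / k + deg H v / k ≤ b := by
      rw [← add_div, div_le_iff₀ hk']; linarith
    linarith
  · have h1 := hH.2.2 u v (part_adj.mp hG).1
      fun h => hn (part_adj.mpr ⟨h, (part_adj.mp hG).2⟩)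
    have h2 := (abs_le.mp (hω u)).1
    have h3 := (abs_le.mp (hω v)).1
    have h4 : bm ≤ (deg H u : ℝ) / k + deg H v / k := by
      rw [← add_div, le_div_iff₀ hk']; linarith
    linarith

/-- Degrees in the parts of a random partition are concentrated. -/
lemma ncard_deg_part_deviation_le {V : Type*} [Fintype V] [DecidableEq V] {H : SimpleGraph V}
    {k : ℕ} (hk : 1 ≤ k) {μ δ : ℝ} (hμ : ∀ v, (deg H v : ℝ) ≤ k * μ) (hδ : 0 ≤ δ) (hδ' : δ ≤ 1) :
    (({ω : Sym2 V → Fin k | ∃ i v, 2 * δ * μ ≤ |(deg (part H ω i) v : ℝ) - deg H v / k|} :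
      Set (Sym2 V → Fin k)).ncard : ℝ) ≤
      (k * Fintype.card V) *
        (2 * (Fintype.card (Sym2 V → Fin k) * Real.exp (-(δ ^ 2 * μ)))) := by
  classical
  have h1 : ∀ p : Fin k × V, (({ω : Sym2 V → Fin k |
      2 * δ * μ ≤ |(deg (part H ω p.1) p.2 : ℝ) - deg H p.2 / k|} :
      Set (Sym2 V → Fin k)).ncard : ℝ) ≤
      2 * (Fintype.card (Sym2 V → Fin k) * Real.exp (-(δ ^ 2 * μ))) := by
    rintro ⟨i, v⟩
    have hinj : Function.Injective fun u => s(v, u) := fun u w h => Sym2.congr_right.mp h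
    let S := (Finset.univ.filter fun u => H.Adj v u).image fun u => s(v, u)
    have hS : S.card = deg H v := by
      rw [Finset.card_image_of_injective _ hinj, deg_eq_card]
    have hSi : ∀ ω : Sym2 V → Fin k,
        (S.filter fun e => ω e = i).card = deg (part H ω i) v := by
      intro ω
      rw [Finset.filter_image, Finset.card_image_of_injective _ hinj, Finset.filter_filter,
        deg_eq_card]
      simp only [part_adj]
    have := card_deviation_le hk i S (μ := μ) (δ := δ) (by rw [hS]; exact hμ v) hδ hδ'
    simpa only [hS, hSi] using this
  have h2 := ncard_iUnion_le_mul _ h1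
  have h3 : ({ω : Sym2 V → Fin k | ∃ i v, 2 * δ * μ ≤
      |(deg (part H ω i) v : ℝ) - deg H v / k|} : Set (Sym2 V → Fin k)) =
      ⋃ p : Fin k × V, {ω : Sym2 V → Fin k |
        2 * δ * μ ≤ |(deg (part H ω p.1) p.2 : ℝ) - deg H p.2 / k|} := by
    ext ω
    simp
  rw [h3]
  simpa using h2

lemma IsEDCS.mono {V : Type*} {G H : SimpleGraph V} {b b' bm bm' : ℝ} (h : IsEDCS G H b bm)
    (hb : b ≤ b') (hbm : bm' ≤ bm) : IsEDCS G H b' bm' :=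
  ⟨h.1, fun u v huv => (h.2.1 u v huv).trans hb, fun u v hG hn => hbm.trans (h.2.2 u v hG hn)⟩

/-- If the degrees of a fixed subgraph `H` are split evenly by the partition, then the union of
the edge degree constrained subgraphs of the parts has a large matching. -/
lemma MM_iSup_ge {V : Type*} [Fintype V] {G H : SimpleGraph V} {k : ℕ} {ω : Sym2 V → Fin k}
    {F : Fin k → SimpleGraph V} {ε lam β : ℝ} (hk : 1 ≤ k) (hε : 0 < ε) (hε1 : ε < 1)
    (hβ : 0 < β) (hlam : 0 ≤ lam) (hlamε : lam ≤ ε / 200)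
    (hH : IsEDCS G H (k * ((1 - lam / 2) * β)) (k * ((1 - lam) * β)))
    (hω : ∀ i v, |(deg (part H ω i) v : ℝ) - deg H v / k| ≤ lam * β / 8)
    (hF : ∀ i, IsEDCS (part G ω i) (F i) β ((1 - lam) * β)) (J : ℕ)
    (hJ : 4 * J * lam ≤ ε / 400) (hJn : (Fintype.card V : ℝ) ^ 2 < (1 + ε / 400) ^ J)
    (hn : 2 * (Fintype.card V : ℝ) * Real.exp (-(ε ^ 2 * β / 40000)) < 1) :
    (2 / 3 - ε) * (MM G : ℝ) ≤ MM (⨆ i, F i) := by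
  have hk' : (1 : ℝ) ≤ k := by exact_mod_cast hk
  have hlβ : 0 ≤ lam * β := by positivity
  have hlβε : lam * β ≤ ε * β / 200 := by
    have := mul_le_mul_of_nonneg_right hlamε hβ.le
    linarith
  have hclose : ∀ i v, |(deg (F i) v : ℝ) - deg H v / k| ≤ ε * β / 100 := by
    intro i v
    have hA : IsEDCS (part G ω i) (F i) β (β - 2 * lam * β) := (hF i).mono le_rfl (by linarith)
    have hB : IsEDCS (part G ω i) (part H ω i) β (β - 2 * lam * β) :=
      (isEDCS_part hk hH (hω i)).mono (by linarith) (by linarith)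
    have ht : 0 < ε * β / 200 := by positivity
    have hγ : 0 ≤ 2 * lam * β := by positivity
    have hJ' : 2 * J * (2 * lam * β) ≤ ε * β / 200 / 2 := by
      have := mul_le_mul_of_nonneg_right hJ hβ.le
      linarith
    have hq : ε * β / 200 / (2 * β) = ε / 400 := by field_simp; norm_num
    have h1 := deg_sub_deg_lt hβ hγ ht hA hB J hJ' (by rw [hq]; exact hJn) v
    have h2 := deg_sub_deg_lt hβ hγ ht hB hA J hJ' (by rw [hq]; exact hJn) v
    have h3 := abs_le.mp (hω i v)
    rw [abs_le]
    constructor <;> linarith [h3.1, h3.2]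
  have hC := isEDCS_iSup (fun v => (deg H v : ℝ) / k) hF hclose
  have hQ : 0 < k * β := by positivity
  set Q := k * β with hQdef
  have hb : k * (β + 4 * (ε * β / 100)) = Q * (1 + ε / 25) := by rw [hQdef]; ring
  have hbm : k * ((1 - lam) * β - 4 * (ε * β / 100)) = Q * (1 - lam - ε / 25) := by
    rw [hQdef]; ring
  rw [hb, hbm] at hC
  have hlow : Q * (1 / 2 - ε / 25) ≤ Q * (1 - lam - ε / 25) / 2 - ε * Q / 100 := by
    have := mul_le_mul_of_nonneg_left hlamε hQ.le
    nlinarith [mul_pos hε hQ]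
  have hlow0 : 0 < Q * (1 / 2 - ε / 25) := mul_pos hQ (by linarith)
  have hmain := MM_mul_le_of_isEDCS hC (a := ε * Q / 100) (by positivity)
    (hlow0.trans_le hlow) (mul_le_mul_of_nonneg_left (by linarith) hQ.le) (by
      refine lt_of_le_of_lt ?_ hn
      refine mul_le_mul_of_nonneg_left (Real.exp_le_exp.mpr (neg_le_neg ?_)) (by positivity)
      rw [le_div_iff₀ (by positivity)]
      have h1 : β ≤ Q := by rw [hQdef]; nlinarith
      calc ε ^ 2 * β / 40000 * (2 * (Q * (1 + ε / 25)))
          ≤ ε ^ 2 * Q / 40000 * (2 * (Q * 2)) := by gcongr; linarith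
        _ = (ε * Q / 100) ^ 2 := by ring)
  set bm' := Q * (1 - lam - ε / 25) / 2 - ε * Q / 100 with hbm'
  have hbm0 : 0 < bm' := hlow0.trans_le hlow
  have hratio : Q * (1 + ε / 25) / 2 + ε * Q / 100 ≤ (1 + ε) * bm' := by
    refine le_trans ?_ (mul_le_mul_of_nonneg_left hlow (by linarith : 0 ≤ 1 + ε))
    have h1 : (1 + ε / 25) / 2 + ε / 100 ≤ (1 + ε) * (1 / 2 - ε / 25) := by nlinarith
    have := mul_le_mul_of_nonneg_left h1 hQ.le
    linarith
  have hc0 : (0 : ℝ) ≤ MM (⨆ i, F i) := by positivity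
  have hm0 : (0 : ℝ) ≤ MM G := by positivity
  have h1 : (MM G : ℝ) ≤ MM (⨆ i, F i) * (3 / 2 + ε) := by
    refine le_of_mul_le_mul_right ?_ hbm0
    refine hmain.trans ?_
    have := mul_le_mul_of_nonneg_left hratio hc0
    linarith
  rcases le_total (2 / 3 - ε) 0 with h2 | h2
  · exact (mul_nonpos_of_nonpos_of_nonneg h2 hm0).trans hc0
  · have h3 := mul_le_mul_of_nonneg_left h1 h2
    have h4 : (2 / 3 - ε) * (3 / 2 + ε) ≤ 1 := by nlinarith
    have h5 := mul_le_mul_of_nonneg_left h4 hc0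
    linarith

lemma exists_layer_count {ε L n : ℝ} (hε : 0 < ε) (hε1 : ε < 1) (hL : 69 / 100 < L)
    (hn : n = Real.exp L) :
    ∃ J : ℕ, 4 * J * (10⁻¹ ^ 7 * ε ^ 2 / L ^ 2) ≤ ε / 400 ∧ n ^ 2 < (1 + ε / 400) ^ J := by
  have hL0 : 0 < L := by linarith
  refine ⟨⌊6250 * L ^ 2 / ε⌋₊, ?_, ?_⟩
  · have h1 : (⌊6250 * L ^ 2 / ε⌋₊ : ℝ) ≤ 6250 * L ^ 2 / ε := Nat.floor_le (by positivity)
    calc _ ≤ 4 * (6250 * L ^ 2 / ε) * (10⁻¹ ^ 7 * ε ^ 2 / L ^ 2) := by gcongr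
      _ = ε / 400 := by field_simp; norm_num
  · have h1 := Nat.lt_floor_add_one (6250 * L ^ 2 / ε)
    set J := ⌊6250 * L ^ 2 / ε⌋₊
    have h2 : 6000 * L ^ 2 / ε ≤ J := by
      have h3 : 1 ≤ 250 * L ^ 2 / ε := by
        rw [le_div_iff₀ hε]; nlinarith
      have h4 : 6250 * L ^ 2 / ε = 6000 * L ^ 2 / ε + 250 * L ^ 2 / ε := by ring
      linarith
    have h3 : Real.exp (ε / 800) ≤ 1 + ε / 400 := by
      have := (abs_le.mp (Real.abs_exp_sub_one_sub_id_le (x := ε / 800)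
        (by rw [abs_of_pos (by positivity)]; linarith))).2
      nlinarith
    calc n ^ 2 = Real.exp (2 * L) := by
          rw [hn, ← Real.exp_nat_mul]; norm_num
      _ < Real.exp (J * (ε / 800)) := by
          rw [Real.exp_lt_exp]
          calc 2 * L < 6000 * L ^ 2 / ε * (ε / 800) := by
                have : 6000 * L ^ 2 / ε * (ε / 800) = 7.5 * L ^ 2 := by field_simp; norm_num
                rw [this]; nlinarith
            _ ≤ _ := by gcongr
      _ = Real.exp (ε / 800) ^ J := Real.exp_nat_mul _ _
      _ ≤ _ := by gcongr

/-- There are absolute constants `c₁, c₂ > 0` such that the following holds.  Let `G` be a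
graph on `n ≥ 2` vertices, `ε ∈ (0,1)`, `1 ≤ k ≤ n`, and set `λ := c₁·ε²/(log n)²` and
`β := c₂·ε⁻⁶·(log n)⁷`.  Take a random `k`-partition `G^(1),…,G^(k)` of `G` and for each
`i` an `EDCS(G^(i), β, (1-λ)β)` denoted `C^(i) := f i G^(i)`, chosen by an arbitrary
deterministic function of `G^(i)`.  Then with probability at least `1 - 4/n⁷`, the union
`C := C^(1) ∪ … ∪ C^(k)` satisfies `MM(C) ≥ (2/3 - ε)·MM(G)` (so the EDCS is a
`(3/2 + O(ε))`-approximation randomized composable coreset for maximum matching). -/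
theorem edcs_coreset_matching :
    ∃ c₁ c₂ : ℝ, 0 < c₁ ∧ 0 < c₂ ∧
      ∀ (V : Type) [Fintype V] [DecidableEq V] (G : SimpleGraph V) (k : ℕ) (ε : ℝ),
        2 ≤ Fintype.card V → 0 < ε → ε < 1 → 1 ≤ k → k ≤ Fintype.card V →
        ∀ f : Fin k → SimpleGraph V → SimpleGraph V,
          (∀ (ω : Sym2 V → Fin k) (i : Fin k),
            IsEDCS (part G ω i) (f i (part G ω i))
              (c₂ * ε⁻¹ ^ 6 * Real.log (Fintype.card V) ^ 7)
              ((1 - c₁ * ε ^ 2 / Real.log (Fintype.card V) ^ 2) *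
                (c₂ * ε⁻¹ ^ 6 * Real.log (Fintype.card V) ^ 7))) →
          1 - 4 / (Fintype.card V : ℝ) ^ 7 ≤
            PrU {ω : Sym2 V → Fin k |
              (2 / 3 - ε) * (MM G : ℝ) ≤
                (MM (⨆ i : Fin k, f i (part G ω i)) : ℝ)} := by
  refine ⟨10⁻¹ ^ 7, 10 ^ 18, by positivity, by positivity, ?_⟩
  intro V _ _ G k ε hV hε hε1 hk hkV f hf
  set n : ℝ := (Fintype.card V : ℝ) with hn
  have hn2 : (2 : ℝ) ≤ n := by rw [hn]; exact_mod_cast hV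
  have hn0 : 0 < n := by linarith
  set L := Real.log n with hLdef
  have hL : 69 / 100 < L := by
    have h1 := Real.log_two_gt_d9
    have h2 := Real.log_le_log (by norm_num) hn2
    linarith
  have hL0 : 0 < L := by linarith
  have hnL : n = Real.exp L := (Real.exp_log hn0).symm
  set β := 10 ^ 18 * ε⁻¹ ^ 6 * L ^ 7 with hβdef
  set lam := 10⁻¹ ^ 7 * ε ^ 2 / L ^ 2 with hlamdef
  have hβ : 0 < β := by positivity
  have hlam : 0 < lam := by positivity
  have hx : 1 ≤ ε⁻¹ := (one_le_inv₀ hε).mpr hε1.le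
  have hL2 : 47 / 100 ≤ L ^ 2 := by nlinarith
  have hlamε : lam ≤ ε / 200 := by
    rw [hlamdef, div_le_iff₀ (by positivity)]
    nlinarith [mul_pos hε hε, mul_le_mul_of_nonneg_left hL2 hε.le]
  have hlamβ : lam ^ 2 * β = 10 ^ 4 * ε⁻¹ ^ 2 * L ^ 3 := by
    rw [hlamdef, hβdef]; field_simp
  have hlam2 : 18 * L ≤ (lam / 16) ^ 2 * β := by
    have h1 : (lam / 16) ^ 2 * β = lam ^ 2 * β / 256 := by ring
    rw [h1, hlamβ]
    have h2 : (1 : ℝ) ≤ ε⁻¹ ^ 2 := one_le_pow₀ hx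
    have h3 : 47 / 100 * L ≤ L ^ 3 := by nlinarith
    have h4 : 1 * (47 / 100 * L) ≤ ε⁻¹ ^ 2 * L ^ 3 := by gcongr
    linarith
  have hlam1 : 4 ≤ lam * β := by nlinarith
  have hε2 : 3 * L ≤ ε ^ 2 * β / 40000 := by
    have h2 : lam ^ 2 * β ≤ ε ^ 2 / 40000 * β := by
      have h3 : lam ^ 2 ≤ (ε / 200) ^ 2 := by gcongr
      have := mul_le_mul_of_nonneg_right h3 hβ.le
      linarith
    have h4 : (lam / 16) ^ 2 * β = lam ^ 2 * β / 256 := by ring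
    linarith
  have hsplit : 2 * n * Real.exp (-(ε ^ 2 * β / 40000)) < 1 := by
    have h1 : Real.exp (-(ε ^ 2 * β / 40000)) ≤ Real.exp (-(3 * L)) := by gcongr
    have h2 : Real.exp (-(3 * L)) = (n ^ 3)⁻¹ := by
      rw [Real.exp_neg, hnL, ← Real.exp_nat_mul]; norm_num
    rw [h2] at h1
    calc _ ≤ 2 * n * (n ^ 3)⁻¹ := by gcongr
      _ = 2 / n ^ 2 := by field_simp
      _ < 1 := by rw [div_lt_one (by positivity)]; nlinarith
  obtain ⟨J, hJ, hJn⟩ := exists_layer_count hε hε1 hL hnL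
  have hk' : (1 : ℝ) ≤ k := by exact_mod_cast hk
  have hkn : (k : ℝ) ≤ n := by rw [hn]; exact_mod_cast hkV
  obtain ⟨H, hH⟩ := exists_isEDCS G (k * ((1 - lam / 2) * β) - 1)
  replace hH : IsEDCS G H (k * ((1 - lam / 2) * β)) (k * ((1 - lam) * β)) :=
    hH.mono (by linarith) (by nlinarith)
  have hHdeg : ∀ v, (deg H v : ℝ) ≤ k * β := by
    refine deg_le_of_edge_bound (by positivity) fun u v huv => (hH.2.1 u v huv).trans ?_
    gcongr
    nlinarith
  have hbad := ncard_deg_part_deviation_le hk hHdeg (δ := lam / 16) (by positivity)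
    (by linarith)
  set bad : Set (Sym2 V → Fin k) := {ω | ∃ i v, 2 * (lam / 16) * β ≤
    |(deg (part H ω i) v : ℝ) - deg H v / k|} with hbaddef
  set good : Set (Sym2 V → Fin k) := {ω | (2 / 3 - ε) * (MM G : ℝ) ≤
    (MM (⨆ i : Fin k, f i (part G ω i)) : ℝ)}
  have hsub : badᶜ ⊆ good := by
    intro ω hω
    simp only [hbaddef, Set.mem_compl_iff, Set.mem_ofPred_eq, not_exists, not_le] at hω
    refine MM_iSup_ge hk hε hε1 hβ hlam.le hlamε hH (fun i v => ?_) (hf ω) J hJ hJn hsplit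
    linarith [hω i v]
  have : Nonempty (Fin k) := ⟨⟨0, hk⟩⟩
  have hN : (0 : ℝ) < Fintype.card (Sym2 V → Fin k) := by exact_mod_cast Fintype.card_pos
  set N : ℝ := (Fintype.card (Sym2 V → Fin k) : ℝ) with hNdef
  have hbad' : (bad.ncard : ℝ) ≤ 4 / n ^ 7 * N := by
    refine hbad.trans ?_
    have h1 : Real.exp (-((lam / 16) ^ 2 * β)) ≤ (n ^ 9)⁻¹ := by
      calc _ ≤ Real.exp (-(9 * L)) := Real.exp_le_exp.mpr (by linarith)
        _ = _ := by rw [Real.exp_neg, hnL, ← Real.exp_nat_mul]; norm_num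
    calc _ ≤ (n * n) * (2 * (N * (n ^ 9)⁻¹)) := by gcongr
      _ = 2 / n ^ 7 * N := by field_simp
      _ ≤ 4 / n ^ 7 * N := by gcongr; norm_num
  have hgood : N ≤ good.ncard + bad.ncard := by
    have h1 := Set.ncard_add_ncard_compl bad
    rw [Nat.card_eq_fintype_card] at h1
    have h2 := Set.ncard_le_ncard hsub (Set.toFinite _)
    rw [hNdef]
    exact_mod_cast (by omega : Fintype.card (Sym2 V → Fin k) ≤ good.ncard + bad.ncard)
  rw [PrU, le_div_iff₀ hN, sub_mul, one_mul]
  linarith
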